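/- Let d ≥ 1 and let Ω ⊂ ℝ^d be compact. There exists a constant C < ∞, depending only on d and diam(Ω), such that for all Borel probability measures μ, ν on Ω, every γ ∈ Π(μ, ν), and every L ∈ (0,1] the following holds. With Q_k^L := L·k + [0,L)^d for k ∈ ℤ^d, define the block approximation γ_L := Σ [γ(Q_j^L × Q_k^L)/(μ(Q_j^L)·ν(Q_k^L))] · (μ ↾ Q_j^L) ⊗ (ν ↾ Q_k^L), the sum running over all j, k ∈ ℤ^d with μ(Q_j^L) > 0 and ν(Q_k^L) > 0. Then: (a) γ_L ∈ Π(μ, ν); (b) W_{Ω×Ω}(γ, γ_L) ≤ L·√(2d), where Ω×Ω ⊂ ℝ^{2d} carries the Euclidean distance; and (c) KL(γ_L | μ⊗ν) ≤ C − 2d·log L. -/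

import Mathlib

open MeasureTheory Set Filter
open scoped ENNReal Classical

noncomputable section

abbrev E (d : ℕ) : Type := EuclideanSpace ℝ (Fin d)

/-- Optimal-transport cost with cost function `c`. -/
noncomputable def OTC {A B : Type*} [MeasurableSpace A] [MeasurableSpace B]
    (c : A → B → ℝ≥0∞) (α : Measure A) (β : Measure B) : ℝ≥0∞ :=
  ⨅ (γ : Measure (A × B)) (_ : γ.map Prod.fst = α) (_ : γ.map Prod.snd = β),
    ∫⁻ p, c p.1 p.2 ∂γ

/-- Euclidean distance on `ℝ^d × ℝ^d = ℝ^{2d}`. -/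
noncomputable def edistE2 {d₁ d₂ : ℕ} (p q : E d₁ × E d₂) : ℝ≥0∞ :=
  ENNReal.ofReal (Real.sqrt (dist p.1 q.1 ^ 2 + dist p.2 q.2 ^ 2))

/-- Kullback–Leibler divergence via `φ(s) = s log s − s + 1`. -/
def KLphi (s : ℝ) : ℝ := s * Real.log s - s + 1

noncomputable def KL {A : Type*} [MeasurableSpace A] (α β : Measure A) : ℝ≥0∞ :=
  if α ≪ β then ∫⁻ x, ENNReal.ofReal (KLphi ((α.rnDeriv β x).toReal)) ∂β else ⊤

/-- Product of two measures. -/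
noncomputable def prodM {A B : Type*} [MeasurableSpace A] [MeasurableSpace B]
    (α : Measure A) (β : Measure B) : Measure (A × B) :=
  α.bind fun a => β.map (Prod.mk a)

/-- Grid cube `Q_k^L = L·k + [0,L)^d`. -/
def QL (d : ℕ) (L : ℝ) (k : Fin d → ℤ) : Set (E d) :=
  {x | ∀ i, L * (k i : ℝ) ≤ x i ∧ x i < L * (k i : ℝ) + L}

/-- Block approximation of `γ ∈ Π(μ, ν)` at scale `L`:
`γ_L = Σ_{j,k} [γ(Q_j×Q_k)/(μ(Q_j)ν(Q_k))] · (μ↾Q_j) ⊗ (ν↾Q_k)`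
(terms with vanishing `μ(Q_j)` or `ν(Q_k)` vanish). -/
noncomputable def blockApprox (d : ℕ) (μ ν : Measure (E d)) (γ : Measure (E d × E d))
    (L : ℝ) : Measure (E d × E d) :=
  Measure.sum fun jk : (Fin d → ℤ) × (Fin d → ℤ) =>
    (γ (QL d L jk.1 ×ˢ QL d L jk.2) / (μ (QL d L jk.1) * ν (QL d L jk.2))) •
      prodM (μ.restrict (QL d L jk.1)) (ν.restrict (QL d L jk.2))

lemma prodM_eq_prod {A B : Type*} [MeasurableSpace A] [MeasurableSpace B]
    (α : Measure A) (β : Measure B) : prodM α β = α.prod β := by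
  rw [prodM, Measure.prod_def]

lemma div_mul_mul_cancel_right {a b c : ℝ≥0∞} (hc : c ≠ 0) (hc' : c ≠ ⊤) :
    a / (b * c) * c = a / b := by
  rw [div_eq_mul_inv, ENNReal.mul_inv (Or.inr hc') (Or.inr hc), mul_assoc, mul_assoc,
    ENNReal.inv_mul_cancel hc hc', mul_one, div_eq_mul_inv]

section FiberBlocks

variable {X Y ι κ : Type*} [MeasurableSpace X] [MeasurableSpace Y]
  [MeasurableSpace ι] [MeasurableSpace κ] [Countable ι] [Countable κ]
  [MeasurableSingletonClass ι] [MeasurableSingletonClass κ]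

/-- Block approximation of `γ` with respect to the fibers of `q` and `r`. -/
def fiberBlock (μ : Measure X) (ν : Measure Y) (γ : Measure (X × Y)) (q : X → ι) (r : Y → κ) :
    Measure (X × Y) :=
  Measure.sum fun jk : ι × κ =>
    (γ ((q ⁻¹' {jk.1}) ×ˢ (r ⁻¹' {jk.2})) / (μ (q ⁻¹' {jk.1}) * ν (r ⁻¹' {jk.2}))) •
      (μ.restrict (q ⁻¹' {jk.1})).prod (ν.restrict (r ⁻¹' {jk.2}))

/-- The density of `fiberBlock μ ν γ q r` with respect to `μ.prod ν`. -/
def fiberDensity (μ : Measure X) (ν : Measure Y) (γ : Measure (X × Y)) (q : X → ι) (r : Y → κ)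
    (p : X × Y) : ℝ≥0∞ :=
  γ ((q ⁻¹' {q p.1}) ×ˢ (r ⁻¹' {r p.2})) / (μ (q ⁻¹' {q p.1}) * ν (r ⁻¹' {r p.2}))

lemma sum_restrict_fiber (μ : Measure X) {q : X → ι} (hq : Measurable q) :
    Measure.sum (fun j => μ.restrict (q ⁻¹' {j})) = μ := by
  have hU : ⋃ j, q ⁻¹' {j} = univ := by
    ext x
    simp
  rw [← Measure.restrict_iUnion (fun i j hij => Disjoint.preimage q (by simpa using hij))
    (fun j => hq (measurableSet_singleton j)), hU, Measure.restrict_univ]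

lemma tsum_restrict_fiber_apply (μ : Measure X) {q : X → ι} (hq : Measurable q) {s : Set X}
    (hs : MeasurableSet s) : ∑' j, μ.restrict (q ⁻¹' {j}) s = μ s := by
  rw [← Measure.sum_apply _ hs, sum_restrict_fiber μ hq]

lemma tsum_div_mul_restrict_fiber {σ : Type*} (μ : Measure X) [IsFiniteMeasure μ] {q : X → ι}
    (hq : Measurable q) (a : ι → σ → ℝ≥0∞) (ha : ∀ j, ∑' k, a j k = μ (q ⁻¹' {j}))
    {s : Set X} (hs : MeasurableSet s) :
    ∑' j, ∑' k, a j k / μ (q ⁻¹' {j}) * μ.restrict (q ⁻¹' {j}) s = μ s := by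
  rw [← tsum_restrict_fiber_apply μ hq hs]
  refine tsum_congr fun j => ?_
  simp_rw [div_eq_mul_inv]
  rw [ENNReal.tsum_mul_right, ENNReal.tsum_mul_right, ha]
  by_cases h : μ (q ⁻¹' {j}) = 0
  · simp [Measure.restrict_eq_zero.2 h]
  · rw [ENNReal.mul_inv_cancel h (measure_ne_top _ _), one_mul]

section Coupling

variable {μ : Measure X} {ν : Measure Y} {γ : Measure (X × Y)}

lemma measure_prod_le_left (h1 : γ.map Prod.fst = μ) {A : Set X} (hA : MeasurableSet A)
    (B : Set Y) : γ (A ×ˢ B) ≤ μ A := by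
  rw [← h1, Measure.map_apply measurable_fst hA]
  exact measure_mono fun p hp => hp.1

lemma measure_prod_le_right (h2 : γ.map Prod.snd = ν) (A : Set X) {B : Set Y}
    (hB : MeasurableSet B) : γ (A ×ˢ B) ≤ ν B := by
  rw [← h2, Measure.map_apply measurable_snd hB]
  exact measure_mono fun p hp => hp.2

lemma tsum_measure_prod_fiber_right (h1 : γ.map Prod.fst = μ) {r : Y → κ} (hr : Measurable r)
    {A : Set X} (hA : MeasurableSet A) : ∑' k, γ (A ×ˢ (r ⁻¹' {k})) = μ A := by
  rw [← h1, Measure.map_apply measurable_fst hA,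
    ← tsum_restrict_fiber_apply γ (hr.comp measurable_snd) (measurable_fst hA)]
  refine tsum_congr fun k => ?_
  rw [Measure.restrict_apply (measurable_fst hA)]
  rfl

lemma tsum_measure_prod_fiber_left (h2 : γ.map Prod.snd = ν) {q : X → ι} (hq : Measurable q)
    {B : Set Y} (hB : MeasurableSet B) : ∑' j, γ ((q ⁻¹' {j}) ×ˢ B) = ν B := by
  rw [← h2, Measure.map_apply measurable_snd hB,
    ← tsum_restrict_fiber_apply γ (hq.comp measurable_fst) (measurable_snd hB)]
  refine tsum_congr fun k => ?_
  rw [Measure.restrict_apply (measurable_snd hB), inter_comm]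
  rfl

lemma fiberBlock_map_fst [IsFiniteMeasure μ] [IsFiniteMeasure ν] (h1 : γ.map Prod.fst = μ)
    (h2 : γ.map Prod.snd = ν) {q : X → ι} {r : Y → κ} (hq : Measurable q) (hr : Measurable r) :
    (fiberBlock μ ν γ q r).map Prod.fst = μ := by
  ext s hs
  rw [fiberBlock, Measure.map_sum measurable_fst.aemeasurable, Measure.sum_apply _ hs,
    ENNReal.tsum_prod', ← tsum_div_mul_restrict_fiber μ hq
      (fun j k => γ ((q ⁻¹' {j}) ×ˢ (r ⁻¹' {k})))
      (fun j => tsum_measure_prod_fiber_right h1 hr (hq (measurableSet_singleton j))) hs]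
  refine tsum_congr fun j => tsum_congr fun k => ?_
  have hle := measure_prod_le_right h2 (q ⁻¹' {j}) (hr (measurableSet_singleton k))
  rw [Measure.map_smul, Measure.map_fst_prod, Measure.smul_apply, Measure.smul_apply,
    Measure.restrict_apply_univ, smul_eq_mul, smul_eq_mul, ← mul_assoc]
  congr 1
  by_cases h : ν (r ⁻¹' {k}) = 0
  · rw [h, nonpos_iff_eq_zero] at hle
    simp [hle]
  · exact div_mul_mul_cancel_right h (measure_ne_top _ _)

lemma fiberBlock_map_snd [IsFiniteMeasure μ] [IsFiniteMeasure ν] (h1 : γ.map Prod.fst = μ)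
    (h2 : γ.map Prod.snd = ν) {q : X → ι} {r : Y → κ} (hq : Measurable q) (hr : Measurable r) :
    (fiberBlock μ ν γ q r).map Prod.snd = ν := by
  ext s hs
  rw [fiberBlock, Measure.map_sum measurable_snd.aemeasurable, Measure.sum_apply _ hs,
    ENNReal.tsum_prod', ENNReal.tsum_comm, ← tsum_div_mul_restrict_fiber ν hr
      (fun k j => γ ((q ⁻¹' {j}) ×ˢ (r ⁻¹' {k})))
      (fun k => tsum_measure_prod_fiber_left h2 hq (hr (measurableSet_singleton k))) hs]
  refine tsum_congr fun k => tsum_congr fun j => ?_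
  have hle := measure_prod_le_left h1 (hq (measurableSet_singleton j)) (r ⁻¹' {k})
  rw [Measure.map_smul, Measure.map_snd_prod, Measure.smul_apply, Measure.smul_apply,
    Measure.restrict_apply_univ, smul_eq_mul, smul_eq_mul, ← mul_assoc]
  congr 1
  by_cases h : μ (q ⁻¹' {j}) = 0
  · rw [h, nonpos_iff_eq_zero] at hle
    simp [hle]
  · rw [mul_comm (μ _)]
    exact div_mul_mul_cancel_right h (measure_ne_top _ _)

lemma measurable_fiberDensity {q : X → ι} {r : Y → κ} (hq : Measurable q) (hr : Measurable r) :
    Measurable (fiberDensity μ ν γ q r) :=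
  (measurable_of_countable fun jk : ι × κ => γ ((q ⁻¹' {jk.1}) ×ˢ (r ⁻¹' {jk.2})) /
    (μ (q ⁻¹' {jk.1}) * ν (r ⁻¹' {jk.2}))).comp (hq.prodMap hr)

lemma fiberBlock_eq_withDensity [SFinite μ] [SFinite ν] {q : X → ι} {r : Y → κ}
    (hq : Measurable q) (hr : Measurable r) :
    fiberBlock μ ν γ q r = (μ.prod ν).withDensity (fiberDensity μ ν γ q r) := by
  have hqr : Measurable (Prod.map q r) := hq.prodMap hr
  rw [← sum_restrict_fiber (μ.prod ν) hqr, withDensity_sum, fiberBlock]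
  congr 1
  funext jk
  have hset : (q ⁻¹' {jk.1}) ×ˢ (r ⁻¹' {jk.2}) = Prod.map q r ⁻¹' {jk} := by
    ext p
    simp [Prod.ext_iff]
  rw [Measure.prod_restrict, hset, ← withDensity_const]
  refine withDensity_congr_ae ?_
  filter_upwards [ae_restrict_mem (hqr (measurableSet_singleton jk))] with p hp
  obtain rfl : Prod.map q r p = jk := hp
  simp only [fiberDensity, ← hset, Prod.map_fst, Prod.map_snd]

lemma OTC_fiberBlock_le [IsFiniteMeasure μ] [IsFiniteMeasure ν] [IsProbabilityMeasure γ]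
    (h1 : γ.map Prod.fst = μ) (h2 : γ.map Prod.snd = ν) {q : X → ι} {r : Y → κ}
    (hq : Measurable q) (hr : Measurable r) (c : X × Y → X × Y → ℝ≥0∞) (K : ℝ≥0∞)
    (hc : ∀ p p' : X × Y, q p.1 = q p'.1 → r p.2 = r p'.2 → c p p' ≤ K) :
    OTC c γ (fiberBlock μ ν γ q r) ≤ K := by
  have hA := fun j : ι => hq (measurableSet_singleton j)
  have hB := fun k : κ => hr (measurableSet_singleton k)
  set Γ : Measure ((X × Y) × (X × Y)) := Measure.sum fun jk : ι × κ =>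
    (μ (q ⁻¹' {jk.1}) * ν (r ⁻¹' {jk.2}))⁻¹ •
      (γ.restrict ((q ⁻¹' {jk.1}) ×ˢ (r ⁻¹' {jk.2}))).prod
        ((μ.restrict (q ⁻¹' {jk.1})).prod (ν.restrict (r ⁻¹' {jk.2}))) with hΓ
  have hfst : Γ.map Prod.fst = γ := by
    have hqr : Measurable (Prod.map q r) := hq.prodMap hr
    conv_rhs => rw [← sum_restrict_fiber γ hqr]
    rw [hΓ, Measure.map_sum measurable_fst.aemeasurable]
    congr 1
    funext jk
    have hset : (q ⁻¹' {jk.1}) ×ˢ (r ⁻¹' {jk.2}) = Prod.map q r ⁻¹' {jk} := by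
      ext p
      simp [Prod.ext_iff]
    have hle1 := measure_prod_le_left h1 (hA jk.1) (r ⁻¹' {jk.2})
    have hle2 := measure_prod_le_right h2 (q ⁻¹' {jk.1}) (hB jk.2)
    rw [← hset, Measure.map_smul, Measure.map_fst_prod, Measure.prod_restrict,
      Measure.restrict_apply_univ, Measure.prod_prod, smul_smul]
    by_cases h : μ (q ⁻¹' {jk.1}) * ν (r ⁻¹' {jk.2}) = 0
    · have h0 : γ ((q ⁻¹' {jk.1}) ×ˢ (r ⁻¹' {jk.2})) = 0 := by
        rcases mul_eq_zero.1 h with h | h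
        · exact nonpos_iff_eq_zero.1 (h ▸ hle1)
        · exact nonpos_iff_eq_zero.1 (h ▸ hle2)
      rw [Measure.restrict_eq_zero.2 h0, smul_zero]
    · rw [ENNReal.inv_mul_cancel h
        (ENNReal.mul_ne_top (measure_ne_top _ _) (measure_ne_top _ _)), one_smul]
  have hsnd : Γ.map Prod.snd = fiberBlock μ ν γ q r := by
    rw [hΓ, Measure.map_sum measurable_snd.aemeasurable, fiberBlock]
    congr 1
    funext jk
    rw [Measure.map_smul, Measure.map_snd_prod, Measure.restrict_apply_univ, smul_smul,
      div_eq_mul_inv, mul_comm]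
  have hcost : ∀ᵐ p ∂Γ, c p.1 p.2 ≤ K := by
    rw [hΓ, Measure.ae_sum_iff]
    intro jk
    refine Measure.ae_smul_measure ?_ _
    rw [Measure.prod_restrict, Measure.prod_restrict]
    refine ae_restrict_of_forall_mem
      (((hA _).prod (hB _)).prod ((hA _).prod (hB _))) fun p hp => ?_
    obtain ⟨⟨ha, hb⟩, ha', hb'⟩ := hp
    exact hc _ _ (Eq.trans ha (Eq.symm ha')) (Eq.trans hb (Eq.symm hb'))
  have huniv : Γ univ = 1 := by
    rw [← preimage_univ (f := Prod.fst), ← Measure.map_apply measurable_fst MeasurableSet.univ,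
      hfst, measure_univ]
  calc OTC c γ (fiberBlock μ ν γ q r) ≤ ∫⁻ p, c p.1 p.2 ∂Γ :=
        iInf₂_le_of_le Γ hfst (iInf_le _ hsnd)
    _ ≤ ∫⁻ _, K ∂Γ := lintegral_mono_ae hcost
    _ = K := by rw [lintegral_const, huniv, mul_one]

end Coupling

lemma KLphi_le {s M N : ℝ} (hs : 0 ≤ s) (hsM : s ≤ M) (hN : 0 < N) :
    KLphi s ≤ s * (Real.log N + (N * M⁻¹)⁻¹) + 1 := by
  rcases hs.eq_or_lt with rfl | hs
  · simp [KLphi]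
  have hM : 0 < M := hs.trans_le hsM
  have h1 : Real.log s ≤ Real.log M := Real.log_le_log hs hsM
  have h2 : Real.log M = Real.log N + Real.log (M / N) := by
    rw [Real.log_div hM.ne' hN.ne']
    ring
  have h3 : Real.log (M / N) ≤ M / N - 1 := Real.log_le_sub_one_of_pos (by positivity)
  have h4 : (N * M⁻¹)⁻¹ = M / N := by
    field_simp
  rw [h4, KLphi]
  nlinarith [mul_le_mul_of_nonneg_left (h1.trans (h2.trans_le (add_le_add_right h3 _))) hs.le]

lemma lintegral_inv_measure_fiber_le (μ : Measure X) [IsFiniteMeasure μ] {q : X → ι}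
    (hq : Measurable q) (S : Finset ι) (hS : ∀ᵐ x ∂μ, q x ∈ S) :
    ∫⁻ x, (μ (q ⁻¹' {q x}))⁻¹ ∂μ ≤ S.card := by
  have hm : Measurable fun j : ι => (μ (q ⁻¹' {j}))⁻¹ := measurable_of_countable _
  rw [← lintegral_map hm hq, lintegral_countable']
  calc ∑' j, (μ (q ⁻¹' {j}))⁻¹ * μ.map q {j}
      ≤ ∑' j, (S : Set ι).indicator 1 j := by
        refine ENNReal.tsum_le_tsum fun j => ?_
        rw [Measure.map_apply hq (measurableSet_singleton j)]
        by_cases hj : j ∈ S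
        · simp [hj]
        · have : μ (q ⁻¹' {j}) = 0 := measure_mono_null (fun x hx => by
            simp only [mem_preimage, mem_singleton_iff] at hx
            simpa [hx] using hj) hS
          simp [this]
    _ = S.card := by
        rw [← tsum_subtype]
        simp

lemma KL_fiberBlock_le {μ : Measure X} {ν : Measure Y} {γ : Measure (X × Y)}
    [IsProbabilityMeasure μ] [IsProbabilityMeasure ν] (h1 : γ.map Prod.fst = μ)
    (h2 : γ.map Prod.snd = ν) {q : X → ι} {r : Y → κ} (hq : Measurable q) (hr : Measurable r)
    (S : Finset ι) (hS : ∀ᵐ x ∂μ, q x ∈ S) {N : ℝ} (hN : 1 ≤ N) (hSN : (S.card : ℝ) ≤ N) :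
    KL (fiberBlock μ ν γ q r) (μ.prod ν) ≤ ENNReal.ofReal (Real.log N + 2) := by
  have hN0 : 0 < N := one_pos.trans_le hN
  have hlog : 0 ≤ Real.log N := Real.log_nonneg hN
  have hf := measurable_fiberDensity (μ := μ) (ν := ν) (γ := γ) hq hr
  have hblock := fiberBlock_eq_withDensity (μ := μ) (ν := ν) (γ := γ) hq hr
  set f := fiberDensity μ ν γ q r with hfdef
  set w : X → ℝ≥0∞ := fun x => ENNReal.ofReal (Real.log N) +
    (ENNReal.ofReal N)⁻¹ * (μ (q ⁻¹' {q x}))⁻¹ with hw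
  have hmw : Measurable w :=
    (measurable_of_countable fun j : ι => ENNReal.ofReal (Real.log N) +
      (ENNReal.ofReal N)⁻¹ * (μ (q ⁻¹' {j}))⁻¹).comp hq
  have hpt : ∀ p, ENNReal.ofReal (KLphi (f p).toReal) ≤ f p * w p.1 + 1 := by
    intro p
    by_cases h0 : γ ((q ⁻¹' {q p.1}) ×ˢ (r ⁻¹' {r p.2})) = 0
    · simp [hfdef, fiberDensity, h0, KLphi]
    set g := γ ((q ⁻¹' {q p.1}) ×ˢ (r ⁻¹' {r p.2}))
    have hle1 : g ≤ _ := measure_prod_le_left h1 (hq (measurableSet_singleton _)) _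
    have hle2 : g ≤ _ := measure_prod_le_right h2 _ (hr (measurableSet_singleton _))
    have hmt : μ (q ⁻¹' {q p.1}) ≠ ⊤ := measure_ne_top _ _
    have hnt : ν (r ⁻¹' {r p.2}) ≠ ⊤ := measure_ne_top _ _
    have hm0 : μ (q ⁻¹' {q p.1}) ≠ 0 := ((pos_iff_ne_zero.2 h0).trans_le hle1).ne'
    have hn0 : ν (r ⁻¹' {r p.2}) ≠ 0 := ((pos_iff_ne_zero.2 h0).trans_le hle2).ne'
    have hfle : f p ≤ (μ (q ⁻¹' {q p.1}))⁻¹ := by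
      calc f p ≤ ν (r ⁻¹' {r p.2}) / (μ (q ⁻¹' {q p.1}) * ν (r ⁻¹' {r p.2})) :=
            ENNReal.div_le_div_right hle2 _
        _ = (μ (q ⁻¹' {q p.1}))⁻¹ := by
            rw [div_eq_mul_inv, ENNReal.mul_inv (Or.inl hm0) (Or.inl hmt), mul_left_comm,
              ENNReal.mul_inv_cancel hn0 hnt, mul_one]
    have hmi : (μ (q ⁻¹' {q p.1}))⁻¹ ≠ ⊤ := ENNReal.inv_ne_top.2 hm0
    have hft : f p ≠ ⊤ := ne_top_of_le_ne_top hmi hfle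
    have hreal := KLphi_le (ENNReal.toReal_nonneg (a := f p)) (ENNReal.toReal_mono hmi hfle) hN0
    refine (ENNReal.ofReal_le_ofReal hreal).trans (le_of_eq ?_)
    rw [ENNReal.ofReal_add (by positivity) zero_le_one, ENNReal.ofReal_mul (by positivity),
      ENNReal.ofReal_toReal hft, ENNReal.ofReal_one, ENNReal.ofReal_add hlog (by positivity),
      mul_inv, inv_inv, ENNReal.ofReal_mul (by positivity), ENNReal.ofReal_toReal hmi,
      ENNReal.ofReal_inv_of_pos hN0]
  have hac : fiberBlock μ ν γ q r ≪ μ.prod ν := hblock ▸ withDensity_absolutelyContinuous _ _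
  rw [KL, if_pos hac, hblock]
  calc ∫⁻ p, ENNReal.ofReal (KLphi (((μ.prod ν).withDensity f).rnDeriv (μ.prod ν) p).toReal)
        ∂μ.prod ν
      = ∫⁻ p, ENNReal.ofReal (KLphi (f p).toReal) ∂μ.prod ν := by
        refine lintegral_congr_ae ?_
        filter_upwards [Measure.rnDeriv_withDensity (μ.prod ν) hf] with p hp
        rw [hp]
    _ ≤ ∫⁻ p, (f p * w p.1 + 1) ∂μ.prod ν := lintegral_mono hpt
    _ = ∫⁻ p, w p.1 ∂((μ.prod ν).withDensity f) + 1 := by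
        rw [lintegral_add_right _ measurable_const, lintegral_one, measure_univ]
        congr 1
        exact (lintegral_withDensity_eq_lintegral_mul _ hf (hmw.comp measurable_fst)).symm
    _ = ∫⁻ x, w x ∂μ + 1 := by
        rw [← hblock, ← lintegral_map hmw measurable_fst, fiberBlock_map_fst h1 h2 hq hr]
    _ ≤ ENNReal.ofReal (Real.log N) + (ENNReal.ofReal N)⁻¹ * S.card + 1 := by
        rw [hw, lintegral_add_left measurable_const, lintegral_const, measure_univ, mul_one,
          lintegral_const_mul' _ _ (by simpa using hN0)]
        gcongr
        exact lintegral_inv_measure_fiber_le μ hq S hS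
    _ ≤ ENNReal.ofReal (Real.log N) + 1 + 1 := by
        gcongr
        have : (S.card : ℝ≥0∞) ≤ ENNReal.ofReal N := by
          rw [← ENNReal.ofReal_natCast]
          exact ENNReal.ofReal_le_ofReal hSN
        exact (mul_le_mul_right this _).trans (ENNReal.inv_mul_le_one _)
    _ = ENNReal.ofReal (Real.log N + 2) := by
        rw [ENNReal.ofReal_add hlog zero_le_two, add_assoc, one_add_one_eq_two]
        simp

end FiberBlocks

/-- Index of the grid cube of side `L` containing a point. -/
def cubeIndex (d : ℕ) (L : ℝ) (x : E d) : Fin d → ℤ := fun i => ⌊x i / L⌋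

lemma measurable_cubeIndex (d : ℕ) (L : ℝ) : Measurable (cubeIndex d L) := by
  unfold cubeIndex
  refine measurable_pi_lambda _ fun i => Measurable.floor ?_
  fun_prop

lemma QL_eq_preimage (d : ℕ) {L : ℝ} (hL : 0 < L) (k : Fin d → ℤ) :
    QL d L k = cubeIndex d L ⁻¹' {k} := by
  ext x
  simp only [QL, mem_ofPred_eq, mem_preimage, mem_singleton_iff, cubeIndex, funext_iff,
    Int.floor_eq_iff, le_div_iff₀ hL, div_lt_iff₀ hL]
  refine forall_congr' fun i => ?_
  rw [add_mul, one_mul, mul_comm L]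

lemma blockApprox_eq_fiberBlock (d : ℕ) (μ ν : Measure (E d)) (γ : Measure (E d × E d))
    {L : ℝ} (hL : 0 < L) :
    blockApprox d μ ν γ L = fiberBlock μ ν γ (cubeIndex d L) (cubeIndex d L) := by
  simp only [blockApprox, fiberBlock, QL_eq_preimage d hL, prodM_eq_prod]

lemma dist_sq_le_of_cubeIndex_eq {d : ℕ} {L : ℝ} (hL : 0 < L) {x y : E d}
    (h : cubeIndex d L x = cubeIndex d L y) : dist x y ^ 2 ≤ d * L ^ 2 := by
  rw [EuclideanSpace.dist_eq, Real.sq_sqrt (by positivity)]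
  calc ∑ i, dist (x i) (y i) ^ 2 ≤ ∑ _i : Fin d, L ^ 2 := by
        refine Finset.sum_le_sum fun i _ => ?_
        have h1 := Int.abs_sub_lt_one_of_floor_eq_floor (congrFun h i)
        rw [← sub_div, abs_div, abs_of_pos hL, div_lt_one hL] at h1
        rw [Real.dist_eq]
        gcongr
    _ = d * L ^ 2 := by simp

lemma edistE2_le_of_cubeIndex_eq {d : ℕ} {L : ℝ} (hL : 0 < L) {p p' : E d × E d}
    (h1 : cubeIndex d L p.1 = cubeIndex d L p'.1) (h2 : cubeIndex d L p.2 = cubeIndex d L p'.2) :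
    edistE2 p p' ≤ ENNReal.ofReal (L * Real.sqrt (2 * d)) := by
  refine ENNReal.ofReal_le_ofReal (Real.sqrt_le_iff.2 ⟨by positivity, ?_⟩)
  rw [mul_pow, Real.sq_sqrt (by positivity)]
  linarith [dist_sq_le_of_cubeIndex_eq hL h1, dist_sq_le_of_cubeIndex_eq hL h2]

lemma exists_finset_cubeIndex {d : ℕ} {Ω : Set (E d)} (hΩ : Bornology.IsBounded Ω)
    {L : ℝ} (hL : 0 < L) :
    ∃ S : Finset (Fin d → ℤ), (∀ x ∈ Ω, cubeIndex d L x ∈ S) ∧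
      (S.card : ℝ) ≤ (2 * (Metric.diam Ω / L) + 2) ^ d := by
  rcases Ω.eq_empty_or_nonempty with rfl | ⟨y, hy⟩
  · exact ⟨∅, by simp, by simp⟩
  set D := Metric.diam Ω
  have hD : 0 ≤ D := Metric.diam_nonneg
  refine ⟨Fintype.piFinset fun i => Finset.Icc ⌊y i / L - D / L⌋ ⌊y i / L + D / L⌋, ?_, ?_⟩
  · intro x hx
    rw [Fintype.mem_piFinset]
    intro i
    have h1 : |x i - y i| ≤ D :=
      (PiLp.norm_apply_le (x - y) i).trans
        ((dist_eq_norm x y).symm.le.trans (Metric.dist_le_diam_of_mem hΩ hx hy))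
    rw [abs_le] at h1
    rw [Finset.mem_Icc]
    constructor
    · refine Int.floor_le_floor ?_
      rw [← sub_div]
      gcongr
      linarith
    · refine Int.floor_le_floor ?_
      rw [← add_div]
      gcongr
      linarith
  · rw [Fintype.card_piFinset, Nat.cast_prod]
    calc ∏ i, ((Finset.Icc ⌊y i / L - D / L⌋ ⌊y i / L + D / L⌋).card : ℝ)
        ≤ ∏ _i : Fin d, (2 * (D / L) + 2) := by
          refine Finset.prod_le_prod (fun _ _ => Nat.cast_nonneg _) fun i _ => ?_
          have hDL : 0 ≤ D / L := by positivity
          have hle : ⌊y i / L - D / L⌋ ≤ ⌊y i / L + D / L⌋ := Int.floor_le_floor (by linarith)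
          rw [Int.card_Icc, ← Int.cast_natCast, Int.toNat_of_nonneg (by linarith)]
          push_cast
          linarith [Int.floor_le (y i / L + D / L), Int.lt_floor_add_one (y i / L - D / L)]
      _ = (2 * (D / L) + 2) ^ d := by simp

/-- the block approximation.  There is a constant `C`, depending only on the
dimension `d` and on `diam Ω`, such that for all probability measures `μ, ν` on the compact
set `Ω`, every coupling `γ ∈ Π(μ,ν)` and every `L ∈ (0,1]`:
(a) `γ_L ∈ Π(μ,ν)`; (b) `W_{Ω×Ω}(γ, γ_L) ≤ L·√(2d)` (Euclidean distance on `ℝ^{2d}`);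
(c) `KL(γ_L | μ⊗ν) ≤ C − 2d·log L`. -/
theorem stmt10 (d : ℕ) (hd : 1 ≤ d) :
    ∃ C : ℝ → ℝ,
      ∀ Ω : Set (E d), IsCompact Ω →
      ∀ μ ν : Measure (E d), IsProbabilityMeasure μ → IsProbabilityMeasure ν →
        μ Ωᶜ = 0 → ν Ωᶜ = 0 →
      ∀ γ : Measure (E d × E d), γ.map Prod.fst = μ → γ.map Prod.snd = ν →
      ∀ L : ℝ, 0 < L → L ≤ 1 →
        (blockApprox d μ ν γ L).map Prod.fst = μ ∧
        (blockApprox d μ ν γ L).map Prod.snd = ν ∧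
        OTC edistE2 γ (blockApprox d μ ν γ L) ≤ ENNReal.ofReal (L * Real.sqrt (2*d)) ∧
        KL (blockApprox d μ ν γ L) (prodM μ ν) ≤
          ENNReal.ofReal (C (Metric.diam Ω) - 2 * d * Real.log L) := by
  refine ⟨fun D => d * Real.log (2 * D + 2) + 2, ?_⟩
  intro Ω hΩ μ ν _ _ hμ _ γ h1 h2 L hL hL1
  have : IsProbabilityMeasure γ := by
    constructor
    rw [← preimage_univ (f := Prod.fst), ← Measure.map_apply measurable_fst MeasurableSet.univ,
      h1, measure_univ]
  have hq := measurable_cubeIndex d L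
  rw [blockApprox_eq_fiberBlock d μ ν γ hL, prodM_eq_prod]
  refine ⟨fiberBlock_map_fst h1 h2 hq hq, fiberBlock_map_snd h1 h2 hq hq,
    OTC_fiberBlock_le h1 h2 hq hq _ _ fun p p' => edistE2_le_of_cubeIndex_eq hL, ?_⟩
  obtain ⟨S, hS, hcard⟩ := exists_finset_cubeIndex hΩ.isBounded hL
  have hD : 0 ≤ Metric.diam Ω := Metric.diam_nonneg
  set D := Metric.diam Ω
  have hDL : 0 ≤ D / L := by positivity
  have hSμ : ∀ᵐ x ∂μ, cubeIndex d L x ∈ S :=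
    measure_mono_null (fun x hx hxΩ => hx (hS x hxΩ)) hμ
  refine (KL_fiberBlock_le h1 h2 hq hq S hSμ (one_le_pow₀ (by linarith)) hcard).trans
    (ENNReal.ofReal_le_ofReal ?_)
  have hlogL : Real.log L ≤ 0 := Real.log_nonpos hL.le hL1
  have hlog : Real.log (2 * (D / L) + 2) ≤ Real.log (2 * D + 2) - Real.log L := by
    rw [← Real.log_div (by positivity) hL.ne']
    refine Real.log_le_log (by positivity) ?_
    rw [le_div_iff₀ hL, add_mul, mul_assoc, div_mul_cancel₀ _ hL.ne']
    linarith
  rw [Real.log_pow]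
  have hd0 : (0 : ℝ) ≤ d := Nat.cast_nonneg d
  nlinarith [mul_le_mul_of_nonneg_left hlog hd0, mul_nonneg hd0 (neg_nonneg.2 hlogL)]
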